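/- arXiv:2206.03426 — 2 statements merged into one kernel-verified Lean document; each statement's English description precedes it below -/
import Mathlib

section
/- Let μ1 and μ0 be probability measures on a measurable space E, and let D* : E → ℝ denote (the real-valued version of) the Radon–Nikodym derivative of μ1 with respect to μ1 + μ0, so that 0 ≤ D* ≤ 1 holds (μ1+μ0)-almost everywhere. Then for every measurable function D : E → ℝ with 0 < D(x) < 1 for all x ∈ E, assuming all four integrals below exist (are finite or equal −∞ on the right), one has ∫ log(D) dμ1 + ∫ log(1 − D) dμ0 ≤ ∫ log(D*) dμ1 + ∫ log(1 − D*) dμ0. In other words, D* maximizes the discriminator objective ∫ log(D) dμ1 + ∫ log(1 − D) dμ0 over measurable discriminators D with values in (0,1). -/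
open MeasureTheory Real

theorem mul_log_le_mul_log_add_sub {d t : ℝ} (hd : 0 ≤ d) (ht : 0 < t) :
    d * log t ≤ d * log d + (t - d) := by
  rcases hd.eq_or_lt with rfl | hd
  · simpa using ht.le
  · have h := mul_le_mul_of_nonneg_left (log_le_sub_one_of_pos (div_pos ht hd)) hd.le
    rw [log_div ht.ne' hd.ne', mul_sub, mul_sub, mul_div_cancel₀ _ hd.ne'] at h
    linarith

theorem toReal_rnDeriv_add_left_add_right {E : Type*} [MeasurableSpace E] (μ ν : Measure E)
    [IsFiniteMeasure μ] [IsFiniteMeasure ν] :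
    ∀ᵐ x ∂(μ + ν), (ν.rnDeriv (μ + ν) x).toReal = 1 - (μ.rnDeriv (μ + ν) x).toReal := by
  filter_upwards [Measure.rnDeriv_add μ ν (μ + ν), Measure.rnDeriv_self (μ + ν),
    Measure.rnDeriv_lt_top μ (μ + ν), Measure.rnDeriv_lt_top ν (μ + ν)] with x hadd hself hμ hν
  rw [hself, Pi.add_apply] at hadd
  have h := congrArg ENNReal.toReal hadd
  rw [ENNReal.toReal_add hμ.ne hν.ne, ENNReal.toReal_one] at h
  linarith

/-- The optimal discriminator: let `μ1, μ0` be probability measures, and let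
`D* = dμ1/d(μ1+μ0)` (real-valued version of the Radon–Nikodym derivative), which satisfies
`0 ≤ D* ≤ 1` `(μ1+μ0)`-a.e.  Then for every measurable `D` with values in `(0,1)`,
assuming all four integrals exist,
`∫ log D dμ1 + ∫ log (1-D) dμ0 ≤ ∫ log D* dμ1 + ∫ log (1-D*) dμ0`. -/
theorem optimal_discriminator {E : Type*} [MeasurableSpace E]
    (μ1 μ0 : Measure E) [IsProbabilityMeasure μ1] [IsProbabilityMeasure μ0]
    (Dstar : E → ℝ) (hDstar : Dstar = fun x => (μ1.rnDeriv (μ1 + μ0) x).toReal)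
    (hDstar01 : ∀ᵐ x ∂(μ1 + μ0), 0 ≤ Dstar x ∧ Dstar x ≤ 1)
    (D : E → ℝ) (hDmeas : Measurable D) (hD : ∀ x, 0 < D x ∧ D x < 1)
    (h1 : Integrable (fun x => Real.log (D x)) μ1)
    (h2 : Integrable (fun x => Real.log (1 - D x)) μ0)
    (h3 : Integrable (fun x => Real.log (Dstar x)) μ1)
    (h4 : Integrable (fun x => Real.log (1 - Dstar x)) μ0) :
    ∫ x, Real.log (D x) ∂μ1 + ∫ x, Real.log (1 - D x) ∂μ0 ≤
      ∫ x, Real.log (Dstar x) ∂μ1 + ∫ x, Real.log (1 - Dstar x) ∂μ0 := by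
  have hμ1 : μ1 ≪ μ1 + μ0 := Measure.AbsolutelyContinuous.rfl.add_right μ0
  have hμ0 : μ0 ≪ μ1 + μ0 := by
    rw [add_comm]
    exact Measure.AbsolutelyContinuous.rfl.add_right μ1
  have i1 := (integrable_rnDeriv_smul_iff hμ1).2 h1
  have i2 := (integrable_rnDeriv_smul_iff hμ0).2 h2
  have i3 := (integrable_rnDeriv_smul_iff hμ1).2 h3
  have i4 := (integrable_rnDeriv_smul_iff hμ0).2 h4
  rw [← integral_rnDeriv_smul hμ1, ← integral_rnDeriv_smul hμ0, ← integral_rnDeriv_smul hμ1,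
    ← integral_rnDeriv_smul hμ0, ← integral_add i1 i2, ← integral_add i3 i4]
  refine integral_mono_ae (i1.add i2) (i3.add i4) ?_
  filter_upwards [hDstar01, toReal_rnDeriv_add_left_add_right μ1 μ0] with x ⟨h_nonneg, h_le⟩ hx
  have hd : (μ1.rnDeriv (μ1 + μ0) x).toReal = Dstar x := by rw [hDstar]
  simp only [smul_eq_mul, hx, hd]
  have hl := mul_log_le_mul_log_add_sub h_nonneg (hD x).1
  have hr := mul_log_le_mul_log_add_sub (sub_nonneg.2 h_le) (sub_pos.2 (hD x).2)
  linarith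
end

section
/- Let μ1 and μ0 be probability measures on a measurable space E, and let D* : E → ℝ denote (the real-valued version of) the Radon–Nikodym derivative of μ1 with respect to μ1 + μ0. Then ∫ (D*(x) − 1/2)² d(μ1 + μ0)(x) = 0 if and only if μ1 = μ0. -/
open MeasureTheory

open scoped ENNReal

lemma MeasureTheory.Measure.eq_inv_two_smul_add_iff {E : Type*} [MeasurableSpace E]
    (μ ν : Measure E) [IsFiniteMeasure μ] :
    μ = (2⁻¹ : ℝ≥0∞) • (μ + ν) ↔ μ = ν := by
  have half : (2⁻¹ : ℝ≥0∞) • (μ + μ) = μ := by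
    rw [smul_add, ← add_smul, ENNReal.inv_two_add_inv_two, one_smul]
  refine ⟨fun h ↦ ?_, by rintro rfl; exact half.symm⟩
  have h2 : μ + μ = μ + ν := by
    conv_lhs => rw [h]
    rw [← add_smul, ENNReal.inv_two_add_inv_two, one_smul]
  ext s _
  have hs := congrArg (fun m : Measure E ↦ m s) h2
  simpa [ENNReal.add_right_inj (measure_ne_top μ s)] using hs

lemma MeasureTheory.Measure.rnDeriv_add_ae_eq_inv_two_iff {E : Type*} [MeasurableSpace E]
    (μ ν : Measure E) [IsFiniteMeasure μ] [IsFiniteMeasure ν] :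
    μ.rnDeriv (μ + ν) =ᵐ[μ + ν] (fun _ ↦ (2⁻¹ : ℝ≥0∞)) ↔ μ = ν := by
  rw [← μ.eq_inv_two_smul_add_iff ν, ← withDensity_const]
  constructor
  · intro h
    rw [← withDensity_congr_ae h, Measure.withDensity_rnDeriv_eq]
    exact Measure.absolutelyContinuous_of_le (Measure.le_add_right le_rfl)
  · intro h
    have key := Measure.rnDeriv_withDensity (μ + ν)
      (measurable_const : Measurable fun _ : E ↦ (2⁻¹ : ℝ≥0∞))
    rwa [← h] at key

/-- Let `D*` be the real-valued version of the Radon–Nikodym derivative of `μ1` with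
respect to `μ1 + μ0`.  Then `∫ (D*(x) - 1/2)² d(μ1+μ0) = 0` iff `μ1 = μ0`. -/
theorem generator_loss_zero_iff {E : Type*} [MeasurableSpace E]
    (μ1 μ0 : Measure E) [IsProbabilityMeasure μ1] [IsProbabilityMeasure μ0]
    (Dstar : E → ℝ) (hDstar : Dstar = fun x => (μ1.rnDeriv (μ1 + μ0) x).toReal) :
    ∫ x, (Dstar x - 1 / 2) ^ 2 ∂(μ1 + μ0) = 0 ↔ μ1 = μ0 := by
  have hle := Measure.rnDeriv_le_one_of_le (Measure.le_add_right le_rfl : μ1 ≤ μ1 + μ0)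
  have hmeas : Measurable Dstar := by
    rw [hDstar]; exact (Measure.measurable_rnDeriv _ _).ennreal_toReal
  have hint : Integrable (fun x ↦ (Dstar x - 1 / 2) ^ 2) (μ1 + μ0) := by
    refine Integrable.of_bound ((hmeas.sub_const _).pow_const 2).aestronglyMeasurable 1 ?_
    filter_upwards [hle] with x hx
    have h0 : 0 ≤ Dstar x := by rw [hDstar]; exact ENNReal.toReal_nonneg
    have h1 : Dstar x ≤ 1 := by
      rw [hDstar]; exact ENNReal.toReal_le_of_le_ofReal zero_le_one (by simpa using hx)
    rw [Real.norm_of_nonneg (sq_nonneg _)]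
    nlinarith
  rw [integral_eq_zero_iff_of_nonneg (fun x ↦ sq_nonneg _) hint,
    ← μ1.rnDeriv_add_ae_eq_inv_two_iff μ0]
  refine Filter.eventually_congr ?_
  filter_upwards [hle] with x hx
  have hfin : μ1.rnDeriv (μ1 + μ0) x ≠ ∞ := ne_top_of_le_ne_top ENNReal.one_ne_top hx
  rw [← ENNReal.toReal_eq_toReal_iff' hfin (by simp)]
  simp [hDstar, sub_eq_zero]
end
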